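/- A map Γ from the set of measurable functions f : Ω → ℂ to the set of (not necessarily bounded) linear operators in H coincides with the map f ↦ L(f,E) for a (necessarily unique) positive operator measure E : 𝒜 → L(H) if and only if the following four conditions hold: (i) Γ restricted to bounded measurable functions is a positive linear map with values in L(H); (ii) if (f_n) is an increasing sequence of positive measurable functions converging pointwise to a bounded measurable function f, then sup_n ⟨φ, Γ(f_n)φ⟩ = ⟨φ, Γ(f)φ⟩ for each φ ∈ H; (iii) for each measurable f, the domain of Γ(f) consists of exactly those φ ∈ H for which the sequence (Γ(χ_B·f̃_n)φ) converges in norm for every B ∈ 𝒜; (iv) for each φ in the domain of Γ(f), the sequence (Γ(f̃_n)φ) converges to Γ(f)φ. -/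

import Mathlib

open MeasureTheory Filter Topology ComplexConjugate

noncomputable section

local notation "⟪" x ", " y "⟫" => @inner ℂ _ _ x y

/-- The total variation measure of a complex measure. -/
def MeasureTheory.ComplexMeasure.tv {Ω : Type*} [MeasurableSpace Ω]
    (ν : MeasureTheory.ComplexMeasure Ω) : MeasureTheory.Measure Ω :=
  (MeasureTheory.ComplexMeasure.re ν).totalVariation +
    (MeasureTheory.ComplexMeasure.im ν).totalVariation

/-- `f` is integrable with respect to the complex measure `ν`: it is integrable with respect
to the total variation measure of `ν`. -/
def MeasureTheory.ComplexMeasure.CIntegrable {Ω : Type*} [MeasurableSpace Ω]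
    (ν : MeasureTheory.ComplexMeasure Ω) (f : Ω → ℂ) : Prop :=
  MeasureTheory.Integrable f ν.tv

/-- The integral of a complex function against a signed measure. -/
def MeasureTheory.SignedMeasure.cintegral {Ω : Type*} [MeasurableSpace Ω]
    (σ : MeasureTheory.SignedMeasure Ω) (f : Ω → ℂ) : ℂ :=
  (∫ x, f x ∂σ.toJordanDecomposition.posPart) - ∫ x, f x ∂σ.toJordanDecomposition.negPart

/-- The integral of a complex function against a complex measure. -/
def MeasureTheory.ComplexMeasure.cintegral {Ω : Type*} [MeasurableSpace Ω]
    (ν : MeasureTheory.ComplexMeasure Ω) (f : Ω → ℂ) : ℂ :=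
  (MeasureTheory.ComplexMeasure.re ν).cintegral f +
    Complex.I * (MeasureTheory.ComplexMeasure.im ν).cintegral f

/-- The truncation `f̃ₙ` of `f` : `f̃ₙ(x) = f(x)` if `|f(x)| ≤ n`, and `f̃ₙ(x) = 0` otherwise. -/
def trunc {Ω : Type*} (f : Ω → ℂ) (n : ℕ) : Ω → ℂ :=
  fun x => if ‖f x‖ ≤ (n : ℝ) then f x else 0

/-- A bounded function. -/
def Bdd {Ω : Type*} (f : Ω → ℂ) : Prop := ∃ C : ℝ, ∀ x, ‖f x‖ ≤ C

theorem norm_trunc_le {Ω : Type*} (f : Ω → ℂ) (n : ℕ) (x : Ω) :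
    ‖trunc f n x‖ ≤ n ∧ ‖trunc f n x‖ ≤ ‖f x‖ := by
  unfold trunc; split_ifs with h <;> simp [h]

theorem trunc_bdd {Ω : Type*} (f : Ω → ℂ) (n : ℕ) : Bdd (trunc f n) :=
  ⟨n, fun x => (norm_trunc_le f n x).1⟩

theorem trunc_eventually_eq {Ω : Type*} (f : Ω → ℂ) (x : Ω) :
    ∀ᶠ n in atTop, trunc f n x = f x := by
  obtain ⟨N, hN⟩ := exists_nat_ge ‖f x‖
  filter_upwards [eventually_ge_atTop N] with n hn
  exact if_pos (hN.trans (by exact_mod_cast hn))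

theorem trunc_indicator {Ω : Type*} (f : Ω → ℂ) (B : Set Ω) (n : ℕ) :
    trunc (B.indicator f) n = B.indicator (trunc f n) := by
  funext x
  by_cases hx : x ∈ B <;> simp [trunc, hx]

section Integral

variable {Ω : Type*} [MeasurableSpace Ω]

theorem MeasureTheory.SignedMeasure.exists_sign (s : SignedMeasure Ω) :
    ∃ σ : Ω → ℝ, Measurable σ ∧ (∀ x, |σ x| = 1) ∧
      ∀ g : Ω → ℂ, Integrable g s.totalVariation →
        s.cintegral g = ∫ x, (σ x : ℂ) * g x ∂s.totalVariation := by
  classical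
  obtain ⟨S, hS, hp, hn⟩ := s.toJordanDecomposition.mutuallySingular
  set σ : Ω → ℝ := S.piecewise (fun _ => -1) (fun _ => 1) with hσdef
  have hσm : Measurable σ := Measurable.piecewise hS measurable_const measurable_const
  have hσ1 : ∀ x, |σ x| = 1 := fun x => by by_cases hx : x ∈ S <;> simp [hσdef, hx]
  refine ⟨σ, hσm, hσ1, fun g hg => ?_⟩
  · have hσ : Integrable (fun x => (σ x : ℂ) * g x) s.totalVariation :=
      hg.bdd_mul (c := 1) (Complex.measurable_ofReal.comp hσm).aestronglyMeasurable
        (Eventually.of_forall fun x => by simp [hσ1 x])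
    rw [SignedMeasure.totalVariation] at hσ ⊢
    rw [integral_add_measure hσ.left_of_add_measure hσ.right_of_add_measure,
      SignedMeasure.cintegral, sub_eq_add_neg, ← integral_neg]
    congr 1
    · refine integral_congr_ae ?_
      filter_upwards [measure_eq_zero_iff_ae_notMem.1 hp] with x hx
      simp [hσdef, hx]
    · refine integral_congr_ae ?_
      filter_upwards [measure_eq_zero_iff_ae_notMem.1 hn] with x hx
      have : x ∈ S := by simpa using hx
      simp [hσdef, this]

instance (ν : ComplexMeasure Ω) : IsFiniteMeasure ν.tv := by
  unfold ComplexMeasure.tv; infer_instance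

/-- Polar decomposition of a complex measure, up to equivalence of norms. -/
theorem MeasureTheory.ComplexMeasure.exists_density (ν : ComplexMeasure Ω) :
    ∃ h : Ω → ℂ, Measurable h ∧ (∀ᵐ x ∂ν.tv, 1 / 2 ≤ ‖h x‖ ∧ ‖h x‖ ≤ 1) ∧
      ∀ g : Ω → ℂ, Integrable g ν.tv → ν.cintegral g = ∫ x, h x * g x ∂ν.tv := by
  set V₁ := (ComplexMeasure.re ν).totalVariation with hV₁
  set V₂ := (ComplexMeasure.im ν).totalVariation with hV₂
  have hμ : ν.tv = V₁ + V₂ := rfl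
  obtain ⟨σ₁, hσ₁m, hσ₁, h₁⟩ := SignedMeasure.exists_sign (ComplexMeasure.re ν)
  obtain ⟨σ₂, hσ₂m, hσ₂, h₂⟩ := SignedMeasure.exists_sign (ComplexMeasure.im ν)
  rw [← hV₁] at h₁
  rw [← hV₂] at h₂
  have ac₁ : V₁ ≪ ν.tv := hμ ▸ Measure.AbsolutelyContinuous.rfl.add_right _
  have ac₂ : V₂ ≪ ν.tv := by
    rw [hμ, add_comm]; exact Measure.AbsolutelyContinuous.rfl.add_right _
  set a : Ω → ℝ := fun x => (V₁.rnDeriv ν.tv x).toReal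
  set b : Ω → ℝ := fun x => (V₂.rnDeriv ν.tv x).toReal
  have ham : Measurable a := (Measure.measurable_rnDeriv _ _).ennreal_toReal
  have hbm : Measurable b := (Measure.measurable_rnDeriv _ _).ennreal_toReal
  have hab : ∀ᵐ x ∂ν.tv, a x + b x = 1 := by
    have e := Measure.rnDeriv_add V₁ V₂ ν.tv
    rw [← hμ] at e
    filter_upwards [e, Measure.rnDeriv_self ν.tv, Measure.rnDeriv_lt_top V₁ ν.tv,
      Measure.rnDeriv_lt_top V₂ ν.tv] with x hx hx1 hx2 hx3
    rw [hx1, Pi.add_apply] at hx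
    simp only [a, b]
    rw [← ENNReal.toReal_add hx2.ne hx3.ne, ← hx, ENNReal.toReal_one]
  have key : ∀ (V : Measure Ω) [IsFiniteMeasure V] (σ : Ω → ℝ), V ≪ ν.tv → V ≤ ν.tv →
      Measurable σ → (∀ x, |σ x| = 1) → ∀ g : Ω → ℂ, Integrable g ν.tv →
      Integrable (fun x => ((σ x * (V.rnDeriv ν.tv x).toReal : ℝ) : ℂ) * g x) ν.tv ∧
      ∫ x, ((σ x * (V.rnDeriv ν.tv x).toReal : ℝ) : ℂ) * g x ∂ν.tv
        = ∫ x, (σ x : ℂ) * g x ∂V := by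
    intro V _ σ hac hle hσm hσ g hg
    have e : (fun x => ((σ x * (V.rnDeriv ν.tv x).toReal : ℝ) : ℂ) * g x)
        = fun x => (V.rnDeriv ν.tv x).toReal • ((σ x : ℂ) * g x) := by
      funext x; simp only [Complex.real_smul]; push_cast; ring
    rw [e]
    refine ⟨?_, integral_rnDeriv_smul hac⟩
    rw [integrable_rnDeriv_smul_iff hac]
    exact (hg.mono_measure hle).bdd_mul (c := 1)
      (Complex.measurable_ofReal.comp hσm).aestronglyMeasurable
      (Eventually.of_forall fun x => by simp [hσ x])
  refine ⟨fun x => ((σ₁ x * a x : ℝ) : ℂ) + Complex.I * ((σ₂ x * b x : ℝ) : ℂ), by fun_prop,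
    ?_, fun g hg => ?_⟩
  · filter_upwards [hab] with x hx
    have ha0 : 0 ≤ a x := ENNReal.toReal_nonneg
    have hb0 : 0 ≤ b x := ENNReal.toReal_nonneg
    have hn : ‖((σ₁ x * a x : ℝ) : ℂ) + Complex.I * ((σ₂ x * b x : ℝ) : ℂ)‖ ^ 2
        = a x ^ 2 + b x ^ 2 := by
      rw [Complex.sq_norm, mul_comm Complex.I, Complex.normSq_add_mul_I, mul_pow, mul_pow,
        ← sq_abs (σ₁ x), ← sq_abs (σ₂ x), hσ₁, hσ₂]
      ring
    have h0 := norm_nonneg (((σ₁ x * a x : ℝ) : ℂ) + Complex.I * ((σ₂ x * b x : ℝ) : ℂ))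
    constructor
    · refine le_of_sq_le_sq ?_ h0
      rw [hn]; nlinarith [sq_nonneg (a x - b x)]
    · refine le_of_sq_le_sq ?_ zero_le_one
      rw [hn]; nlinarith
  · have k₁ := key V₁ σ₁ ac₁ (hμ ▸ Measure.le_add_right le_rfl) hσ₁m hσ₁ g hg
    have k₂ := key V₂ σ₂ ac₂ (hμ ▸ Measure.le_add_left le_rfl) hσ₂m hσ₂ g hg
    have e : (fun x => (((σ₁ x * a x : ℝ) : ℂ) + Complex.I * ((σ₂ x * b x : ℝ) : ℂ)) * g x)
        = fun x => ((σ₁ x * a x : ℝ) : ℂ) * g x + Complex.I * (((σ₂ x * b x : ℝ) : ℂ) * g x) := by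
      funext x; ring
    rw [e, integral_add k₁.1 (k₂.1.const_mul _), integral_const_mul, k₁.2, k₂.2,
      ComplexMeasure.cintegral, h₁ g (hg.mono_measure (hμ ▸ Measure.le_add_right le_rfl)),
      h₂ g (hg.mono_measure (hμ ▸ Measure.le_add_left le_rfl))]

variable (ν : ComplexMeasure Ω) {f g : Ω → ℂ}

theorem Bdd.integrable {μ : Measure Ω} [IsFiniteMeasure μ] (hf : Measurable f) (hb : Bdd f) :
    Integrable f μ := by
  obtain ⟨C, hC⟩ := hb
  exact Integrable.of_bound hf.aestronglyMeasurable C (Eventually.of_forall hC)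

theorem MeasureTheory.ComplexMeasure.integrable_density_mul {h : Ω → ℂ} (hm : Measurable h)
    (hh : ∀ᵐ x ∂ν.tv, 1 / 2 ≤ ‖h x‖ ∧ ‖h x‖ ≤ 1) (hg : Integrable g ν.tv) :
    Integrable (fun x => h x * g x) ν.tv :=
  hg.bdd_mul (c := 1) hm.aestronglyMeasurable (hh.mono fun _ hx => hx.2)

theorem MeasureTheory.ComplexMeasure.cintegral_linear (hf : Integrable f ν.tv)
    (hg : Integrable g ν.tv) (c : ℂ) :
    ν.cintegral (fun x => c * f x + g x) = c * ν.cintegral f + ν.cintegral g := by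
  obtain ⟨h, hm, hh, hi⟩ := ν.exists_density
  have hfg : Integrable (fun x => c * f x + g x) ν.tv := (hf.const_mul c).add hg
  rw [hi _ hfg, hi _ hf, hi _ hg, ← integral_const_mul,
    ← integral_add ((ν.integrable_density_mul hm hh hf).const_mul c)
      (ν.integrable_density_mul hm hh hg)]
  exact integral_congr_ae (Eventually.of_forall fun x => by ring)

theorem MeasureTheory.ComplexMeasure.norm_cintegral_le (hf : Integrable f ν.tv) :
    ‖ν.cintegral f‖ ≤ ∫ x, ‖f x‖ ∂ν.tv := by
  obtain ⟨h, hm, hh, hi⟩ := ν.exists_density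
  rw [hi _ hf]
  refine norm_integral_le_of_norm_le hf.norm (hh.mono fun x hx => ?_)
  rw [norm_mul]
  exact mul_le_of_le_one_left (norm_nonneg _) hx.2

theorem MeasureTheory.ComplexMeasure.tendsto_cintegral {F : ℕ → Ω → ℂ} {G : Ω → ℝ}
    (hF : ∀ n, Measurable (F n)) (hf : Integrable f ν.tv) (hG : Integrable G ν.tv)
    (hle : ∀ n x, ‖F n x‖ ≤ G x) (hlim : ∀ x, Tendsto (fun n => F n x) atTop (𝓝 (f x))) :
    Tendsto (fun n => ν.cintegral (F n)) atTop (𝓝 (ν.cintegral f)) := by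
  obtain ⟨h, hm, hh, hi⟩ := ν.exists_density
  have hFi : ∀ n, Integrable (F n) ν.tv := fun n =>
    hG.mono' (hF n).aestronglyMeasurable (Eventually.of_forall (hle n))
  rw [hi _ hf]
  simp_rw [fun n => hi _ (hFi n)]
  refine tendsto_integral_of_dominated_convergence G
    (fun n => (hm.mul (hF n)).aestronglyMeasurable) hG (fun n => hh.mono fun x hx => ?_)
    (Eventually.of_forall fun x => (hlim x).const_mul _)
  rw [norm_mul]
  exact (mul_le_of_le_one_left (norm_nonneg _) hx.2).trans (hle n x)

theorem MeasureTheory.SignedMeasure.apply_eq_jordan (s : SignedMeasure Ω) {B : Set Ω}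
    (hB : MeasurableSet B) :
    s B = s.toJordanDecomposition.posPart.real B - s.toJordanDecomposition.negPart.real B := by
  conv_lhs => rw [← s.toSignedMeasure_toJordanDecomposition]
  simp [JordanDecomposition.toSignedMeasure, Measure.toSignedMeasure_apply, hB]

theorem MeasureTheory.ComplexMeasure.cintegral_indicator_one {B : Set Ω} (hB : MeasurableSet B) :
    ν.cintegral (B.indicator 1) = ν B := by
  have hs : ∀ s : SignedMeasure Ω, s.cintegral (B.indicator 1) = (s B : ℂ) := by
    intro s
    rw [SignedMeasure.cintegral, integral_indicator hB, integral_indicator hB,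
      s.apply_eq_jordan hB]
    simp
  rw [ComplexMeasure.cintegral, hs, hs]
  have hre : ComplexMeasure.re ν B = (ν B).re := rfl
  have him : ComplexMeasure.im ν B = (ν B).im := rfl
  rw [hre, him, mul_comm, Complex.re_add_im]

theorem trunc_measurable (hf : Measurable f) (n : ℕ) : Measurable (trunc f n) :=
  Measurable.ite (measurableSet_le hf.norm measurable_const) hf measurable_const

theorem MeasureTheory.ComplexMeasure.tendsto_cintegral_trunc (hf : Measurable f)
    (hi : Integrable f ν.tv) :
    Tendsto (fun n => ν.cintegral (trunc f n)) atTop (𝓝 (ν.cintegral f)) :=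
  ν.tendsto_cintegral (trunc_measurable hf) hi hi.norm (fun n x => (norm_trunc_le f n x).2)
    fun x => tendsto_const_nhds.congr' ((trunc_eventually_eq f x).mono fun _ h => h.symm)

theorem MeasureTheory.integrable_of_tendsto_setIntegral {μ : Measure Ω} {v : Ω → ℝ}
    {V : ℕ → Ω → ℝ} (hv : Measurable v) (hV : ∀ n, Integrable (V n) μ)
    (hlim : ∀ x, ∀ᶠ n in atTop, V n x = v x) (hz : ∀ n x, V n x = v x ∨ V n x = 0)
    (hB : ∀ B, MeasurableSet B → ∃ l, Tendsto (fun n => ∫ x in B, V n x ∂μ) atTop (𝓝 l)) :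
    Integrable v μ := by
  have key : ∀ {B : Set Ω}, MeasurableSet B → ∀ {c : ℝ}, (∀ x ∈ B, |v x| = c * v x) →
      IntegrableOn v B μ := by
    intro B hBm c hc
    obtain ⟨l, hl⟩ := hB B hBm
    refine ⟨hv.aestronglyMeasurable, ?_⟩
    have := lintegral_liminf_le' (μ := μ.restrict B) (f := fun n x => ‖V n x‖ₑ) (u := atTop)
      (fun n => (hV n).restrict.aestronglyMeasurable.enorm)
    rw [lintegral_congr (g := fun x => ‖v x‖ₑ) fun x => Tendsto.liminf_eq
      (tendsto_const_nhds.congr' ((hlim x).mono fun _ h => by rw [h]))] at this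
    refine lt_of_le_of_lt this ?_
    have e : ∀ n, ∫⁻ x in B, ‖V n x‖ₑ ∂μ = ENNReal.ofReal (c * ∫ x in B, V n x ∂μ) := by
      intro n
      rw [← integral_const_mul, ← ofReal_integral_norm_eq_lintegral_enorm (hV n).restrict]
      congr 1
      refine setIntegral_congr_fun hBm fun x hx => ?_
      rcases hz n x with h | h
      · simp only [h, Real.norm_eq_abs, hc x hx]
      · simp [h]
    simp_rw [e]
    rw [(ENNReal.tendsto_ofReal (hl.const_mul c)).liminf_eq]
    exact ENNReal.ofReal_lt_top
  have hS : MeasurableSet {x | 0 ≤ v x} := measurableSet_le measurable_const hv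
  have h1 := key hS (c := 1) fun x hx => by simpa using hx
  have h2 := key hS.compl (c := -1) fun x hx => by
    rw [abs_of_neg (by simpa using hx)]; ring
  rw [← integrableOn_univ, ← Set.union_compl_self {x | 0 ≤ v x}]
  exact h1.union h2

theorem MeasureTheory.ComplexMeasure.cIntegrable_of_tendsto (hf : Measurable f)
    (hB : ∀ B, MeasurableSet B →
      ∃ l, Tendsto (fun n => ν.cintegral (B.indicator (trunc f n))) atTop (𝓝 l)) :
    ν.CIntegrable f := by
  obtain ⟨h, hm, hh, hi⟩ := ν.exists_density
  have hti : ∀ n, Integrable (fun x => h x * trunc f n x) ν.tv := fun n =>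
    ν.integrable_density_mul hm hh (Bdd.integrable (trunc_measurable hf n) (trunc_bdd f n))
  have hB' : ∀ B, MeasurableSet B →
      ∃ l, Tendsto (fun n => ∫ x in B, h x * trunc f n x ∂ν.tv) atTop (𝓝 l) := by
    intro B hBm
    obtain ⟨l, hl⟩ := hB B hBm
    refine ⟨l, hl.congr fun n => ?_⟩
    rw [hi _ ((Bdd.integrable (trunc_measurable hf n) (trunc_bdd f n)).indicator hBm),
      ← integral_indicator hBm]
    congr 1
    funext x
    by_cases hx : x ∈ B <;> simp [hx]
  have hz : ∀ n x, trunc f n x = f x ∨ trunc f n x = 0 := fun n x => by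
    unfold trunc; split_ifs <;> simp
  have hre : Integrable (fun x => (h x * f x).re) ν.tv := by
    refine integrable_of_tendsto_setIntegral (V := fun n x => (h x * trunc f n x).re)
      (Complex.measurable_re.comp (hm.mul hf)) (fun n => (hti n).re)
      (fun x => (trunc_eventually_eq f x).mono fun n hn => by rw [hn])
      (fun n x => (hz n x).imp (fun e => by rw [e]) fun e => by simp [e]) fun B hBm => ?_
    obtain ⟨l, hl⟩ := hB' B hBm
    refine ⟨l.re, ((Complex.continuous_re.tendsto l).comp hl).congr fun n => ?_⟩
    exact (integral_re (hti n).restrict).symm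
  have him : Integrable (fun x => (h x * f x).im) ν.tv := by
    refine integrable_of_tendsto_setIntegral (V := fun n x => (h x * trunc f n x).im)
      (Complex.measurable_im.comp (hm.mul hf)) (fun n => (hti n).im)
      (fun x => (trunc_eventually_eq f x).mono fun n hn => by rw [hn])
      (fun n x => (hz n x).imp (fun e => by rw [e]) fun e => by simp [e]) fun B hBm => ?_
    obtain ⟨l, hl⟩ := hB' B hBm
    refine ⟨l.im, ((Complex.continuous_im.tendsto l).comp hl).congr fun n => ?_⟩
    exact (integral_im (hti n).restrict).symm
  refine ((hre.abs.add him.abs).const_mul 2).mono' hf.aestronglyMeasurable (hh.mono fun x hx => ?_)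
  have := Complex.norm_le_abs_re_add_abs_im (h x * f x)
  rw [norm_mul] at this
  simp only [Pi.add_apply]
  nlinarith [norm_nonneg (f x), hx.1]

end Integral

section Induction

open scoped ComplexOrder

variable {Ω : Type*}

theorem Bdd.linear {f g : Ω → ℂ} (hf : Bdd f) (hg : Bdd g) (c : ℂ) :
    Bdd (fun x => c * f x + g x) := by
  obtain ⟨C, hC⟩ := hf
  obtain ⟨D, hD⟩ := hg
  refine ⟨‖c‖ * C + D, fun x => (norm_add_le _ _).trans ?_⟩
  rw [norm_mul]
  exact add_le_add (mul_le_mul_of_nonneg_left (hC x) (norm_nonneg _)) (hD x)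

theorem Bdd.of_le {f : Ω → ℂ} {g : Ω → ℂ} (hg : Bdd g) (h : ∀ x, ‖f x‖ ≤ ‖g x‖) : Bdd f := by
  obtain ⟨C, hC⟩ := hg
  exact ⟨C, fun x => (h x).trans (hC x)⟩

theorem bdd_indicator_one (B : Set Ω) : Bdd (B.indicator (1 : Ω → ℂ)) :=
  ⟨1, fun x => by by_cases hx : x ∈ B <;> simp [hx]⟩

theorem ofReal_add_eq (f g : Ω → ℝ) :
    (fun x => ((f x + g x : ℝ) : ℂ)) = fun x => 1 * (f x : ℂ) + (g x : ℂ) := by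
  funext x
  push_cast
  ring

theorem indicator_const_eq (c : ℝ) (B : Set Ω) :
    (fun x => ((B.indicator (fun _ => c) x : ℝ) : ℂ))
      = fun x => (c : ℂ) * B.indicator 1 x + (0 : Ω → ℂ) x := by
  funext x
  by_cases hx : x ∈ B <;> simp [hx]

variable [MeasurableSpace Ω]

theorem Measurable.linear {f g : Ω → ℂ} (hf : Measurable f) (hg : Measurable g) (c : ℂ) :
    Measurable (fun x => c * f x + g x) := (hf.const_mul c).add hg

theorem bdd_nonneg_induction {P : (Ω → ℝ) → Prop}
    (ind : ∀ c : ℝ, 0 ≤ c → ∀ B : Set Ω, MeasurableSet B → P (B.indicator fun _ => c))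
    (add : ∀ f g : Ω → ℝ, Measurable f → Measurable g → Bdd (fun x => (f x : ℂ)) →
      Bdd (fun x => (g x : ℂ)) → P f → P g → P (fun x => f x + g x))
    (lim : ∀ (F : ℕ → Ω → ℝ) (f : Ω → ℝ), (∀ n, Measurable (F n)) → (∀ n x, 0 ≤ F n x) →
      (∀ x, Monotone fun n => F n x) → (∀ x, Tendsto (fun n => F n x) atTop (𝓝 (f x))) →
      Measurable f → Bdd (fun x => (f x : ℂ)) → (∀ n, P (F n)) → P f)
    {f : Ω → ℝ} (hf : Measurable f) (h0 : ∀ x, 0 ≤ f x) (hb : Bdd (fun x => (f x : ℂ))) : P f := by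
  have bddR : ∀ {u : Ω → ENNReal} {C : NNReal}, (∀ x, u x ≤ C) →
      Bdd (fun x => ((u x).toReal : ℂ)) := fun {u C} hu => ⟨C, fun x => by
    rw [Complex.norm_real, Real.norm_of_nonneg ENNReal.toReal_nonneg]
    exact ENNReal.toReal_le_coe_of_le_coe (hu x)⟩
  have main : ∀ u : Ω → ENNReal, Measurable u → (∃ C : NNReal, ∀ x, u x ≤ C) →
      P (fun x => (u x).toReal) := by
    refine fun u hu => Measurable.ennreal_induction
      (motive := fun u => (∃ C : NNReal, ∀ x, u x ≤ C) → P (fun x => (u x).toReal)) ?_ ?_ ?_ hu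
    · intro c B hB _
      convert ind c.toReal ENNReal.toReal_nonneg B hB using 2 with x
      by_cases hx : x ∈ B <;> simp [hx]
    · rintro f g _ hf hg hPf hPg ⟨C, hC⟩
      have h1 : ∀ x, f x ≤ C := fun x => le_self_add.trans (hC x)
      have h2 : ∀ x, g x ≤ C := fun x => le_add_self.trans (hC x)
      convert add _ _ hf.ennreal_toReal hg.ennreal_toReal (bddR h1) (bddR h2) (hPf ⟨C, h1⟩)
        (hPg ⟨C, h2⟩) using 2 with x
      exact ENNReal.toReal_add (ne_top_of_le_ne_top ENNReal.coe_ne_top (h1 x))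
        (ne_top_of_le_ne_top ENNReal.coe_ne_top (h2 x))
    · rintro F hF hmono hP ⟨C, hC⟩
      have hle : ∀ n x, F n x ≤ C := fun n x => (le_iSup (fun n => F n x) n).trans (hC x)
      refine lim (fun n x => (F n x).toReal) _ (fun n => (hF n).ennreal_toReal)
        (fun _ _ => ENNReal.toReal_nonneg)
        (fun x m n hmn => ENNReal.toReal_mono (ne_top_of_le_ne_top ENNReal.coe_ne_top (hle n x))
          (hmono hmn x))
        (fun x => (ENNReal.tendsto_toReal (ne_top_of_le_ne_top ENNReal.coe_ne_top (hC x))).comp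
          (tendsto_atTop_iSup fun m n hmn => hmono hmn x))
        (Measurable.iSup hF).ennreal_toReal (bddR hC) fun n => hP n ⟨C, hle n⟩
  obtain ⟨C, hC⟩ := hb
  have := main (fun x => ENNReal.ofReal (f x)) hf.ennreal_ofReal ⟨C.toNNReal, fun x => by
    refine ENNReal.ofReal_le_ofReal ?_
    simpa [abs_of_nonneg (h0 x)] using hC x⟩
  simpa only [ENNReal.toReal_ofReal (h0 _)] using this

theorem bdd_induction {P : (Ω → ℂ) → Prop}
    (lin : ∀ (c : ℂ) (f g : Ω → ℂ), Measurable f → Measurable g → Bdd f → Bdd g → P f → P g →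
      P (fun x => c * f x + g x))
    (nonneg : ∀ f : Ω → ℝ, Measurable f → (∀ x, 0 ≤ f x) → Bdd (fun x => (f x : ℂ)) →
      P (fun x => (f x : ℂ)))
    {f : Ω → ℂ} (hf : Measurable f) (hb : Bdd f) : P f := by
  have key : ∀ u : Ω → ℝ, Measurable u → (∀ x, |u x| ≤ ‖f x‖) →
      (Measurable fun x => ((max (u x) 0 : ℝ) : ℂ)) ∧ Bdd (fun x => ((max (u x) 0 : ℝ) : ℂ)) ∧
        P (fun x => ((max (u x) 0 : ℝ) : ℂ)) := by
    intro u hu hle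
    have hm : Measurable fun x => max (u x) 0 := hu.max measurable_const
    have hbd : Bdd (fun x => ((max (u x) 0 : ℝ) : ℂ)) := hb.of_le fun x => by
      rw [Complex.norm_real, Real.norm_of_nonneg (le_max_right _ _)]
      exact max_le ((le_abs_self _).trans (hle x)) (norm_nonneg _)
    exact ⟨Measurable.complex_ofReal hm, hbd, nonneg _ hm (fun x => le_max_right _ _) hbd⟩
  obtain ⟨m₁, b₁, p₁⟩ := key (fun x => (f x).re) (Complex.measurable_re.comp hf)
    fun x => Complex.abs_re_le_norm _
  obtain ⟨m₂, b₂, p₂⟩ := key (fun x => -(f x).re) (Complex.measurable_re.comp hf).neg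
    fun x => by rw [abs_neg]; exact Complex.abs_re_le_norm _
  obtain ⟨m₃, b₃, p₃⟩ := key (fun x => (f x).im) (Complex.measurable_im.comp hf)
    fun x => Complex.abs_im_le_norm _
  obtain ⟨m₄, b₄, p₄⟩ := key (fun x => -(f x).im) (Complex.measurable_im.comp hf).neg
    fun x => by rw [abs_neg]; exact Complex.abs_im_le_norm _
  have q₁ := lin (-1) _ _ m₂ m₁ b₂ b₁ p₂ p₁
  have q₂ := lin (-Complex.I) _ _ m₄ ((m₂.const_mul _).add m₁) b₄ (b₂.linear b₁ _) p₄ q₁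
  have q₃ := lin Complex.I _ _ m₃ ((m₄.const_mul _).add ((m₂.const_mul _).add m₁)) b₃
    (b₄.linear (b₂.linear b₁ _) _) p₃ q₂
  convert q₃ using 1
  have hmax : ∀ r : ℝ, max r 0 - max (-r) 0 = r := fun r => by
    rcases le_total r 0 with h | h <;> simp [h]
  funext x
  apply Complex.ext
  · simp [neg_add_eq_sub, hmax]
  · simp [← sub_eq_add_neg, hmax]

theorem MeasureTheory.ComplexMeasure.tendsto_cintegral_of_monotone (ν : ComplexMeasure Ω)
    {F : ℕ → Ω → ℝ} {f : Ω → ℝ} (hF : ∀ n, Measurable (F n)) (h0 : ∀ n x, 0 ≤ F n x)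
    (hmono : ∀ x, Monotone fun n => F n x)
    (hlim : ∀ x, Tendsto (fun n => F n x) atTop (𝓝 (f x))) (hf : Measurable f)
    (hb : Bdd (fun x => (f x : ℂ))) :
    Tendsto (fun n => ν.cintegral (fun x => (F n x : ℂ))) atTop
      (𝓝 (ν.cintegral (fun x => (f x : ℂ)))) := by
  have hi : Integrable (fun x => (f x : ℂ)) ν.tv :=
    Bdd.integrable (Measurable.complex_ofReal hf) hb
  refine ν.tendsto_cintegral (G := fun x => ‖(f x : ℂ)‖)
    (fun n => Measurable.complex_ofReal (hF n)) hi hi.norm (fun n x => ?_)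
    fun x => (Complex.continuous_ofReal.tendsto _).comp (hlim x)
  rw [Complex.norm_real, Complex.norm_real, Real.norm_of_nonneg (h0 n x)]
  exact ((hmono x).ge_of_tendsto (hlim x) n).trans (le_abs_self _)

theorem MeasureTheory.ComplexMeasure.cintegral_zero (ν : ComplexMeasure Ω) :
    ν.cintegral (0 : Ω → ℂ) = 0 := by
  simpa only [Set.indicator_empty', VectorMeasure.empty] using
    ν.cintegral_indicator_one MeasurableSet.empty

theorem MeasureTheory.ComplexMeasure.cintegral_nonneg (ν : ComplexMeasure Ω)
    (hν : ∀ B, MeasurableSet B → 0 ≤ ν B) {f : Ω → ℝ} (hf : Measurable f) (h0 : ∀ x, 0 ≤ f x)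
    (hb : Bdd (fun x => (f x : ℂ))) : 0 ≤ ν.cintegral (fun x => (f x : ℂ)) := by
  refine bdd_nonneg_induction (P := fun f => 0 ≤ ν.cintegral (fun x => (f x : ℂ))) ?_ ?_ ?_ hf h0 hb
  · intro c hc B hB
    rw [indicator_const_eq, ν.cintegral_linear
      (Bdd.integrable (measurable_one.indicator hB) (bdd_indicator_one B)) (integrable_zero _ _ _),
      ν.cintegral_indicator_one hB, ν.cintegral_zero, add_zero]
    exact mul_nonneg (by exact_mod_cast hc) (hν B hB)
  · intro f g hf hg hfb hgb hPf hPg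
    rw [ofReal_add_eq, ν.cintegral_linear
      (Bdd.integrable (Measurable.complex_ofReal hf) hfb)
      (Bdd.integrable (Measurable.complex_ofReal hg) hgb), one_mul]
    exact add_nonneg hPf hPg
  · intro F f hF h0 hmono hlim hf hb hP
    exact ge_of_tendsto' (ν.tendsto_cintegral_of_monotone hF h0 hmono hlim hf hb) hP

end Induction

section Representation

variable {Ω : Type*} [MeasurableSpace Ω] {H : Type*} [NormedAddCommGroup H]
  [InnerProductSpace ℂ H]

theorem linear_of_inner_eq_cintegral {T : (Ω → ℂ) → H} {N : H → ComplexMeasure Ω}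
    (hT : ∀ g, Measurable g → Bdd g → ∀ ψ, ⟪ψ, T g⟫ = (N ψ).cintegral g) {f g : Ω → ℂ}
    (hf : Measurable f) (hg : Measurable g) (hfb : Bdd f) (hgb : Bdd g) (c : ℂ) :
    T (fun x => c * f x + g x) = c • T f + T g := by
  refine ext_inner_left ℂ fun ψ => ?_
  rw [hT _ (hf.linear hg c) (hfb.linear hgb c), inner_add_right, inner_smul_right,
    hT f hf hfb, hT g hg hgb,
    (N ψ).cintegral_linear (Bdd.integrable hf hfb) (Bdd.integrable hg hgb)]

theorem exists_tendsto_trunc [CompleteSpace H] {T : (Ω → ℂ) → H} {N : H → ComplexMeasure Ω}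
    (hT : ∀ g, Measurable g → Bdd g → ∀ ψ, ⟪ψ, T g⟫ = (N ψ).cintegral g) {f : Ω → ℂ}
    (hf : Measurable f) (hi : ∀ ψ, (N ψ).CIntegrable f) :
    ∃ η, Tendsto (fun n => T (trunc f n)) atTop (𝓝 η) ∧ ∀ ψ, ⟪ψ, η⟫ = (N ψ).cintegral f := by
  obtain ⟨M, hM⟩ : ∃ M, ∀ g, Measurable g → Bdd g → (∀ x, ‖g x‖ ≤ ‖f x‖) → ‖T g‖ ≤ M := by
    obtain ⟨M, hM⟩ := banach_steinhaus
      (ι := {g : Ω → ℂ // Measurable g ∧ Bdd g ∧ ∀ x, ‖g x‖ ≤ ‖f x‖})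
      (g := fun g => innerSL ℂ (T g.1)) fun ψ => ⟨∫ x, ‖f x‖ ∂(N ψ).tv, fun g => by
        rw [innerSL_apply_apply, norm_inner_symm, hT _ g.2.1 g.2.2.1]
        exact ((N ψ).norm_cintegral_le (Bdd.integrable g.2.1 g.2.2.1)).trans
          (integral_mono (Bdd.integrable g.2.1 g.2.2.1).norm (hi ψ).norm g.2.2.2)⟩
    exact ⟨M, fun g h1 h2 h3 => by simpa using hM ⟨g, h1, h2, h3⟩⟩
  have hc : CauchySeq fun n => T (trunc f n) := by
    by_contra hnc
    rw [Metric.cauchySeq_iff] at hnc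
    push Not at hnc
    obtain ⟨ε, hε, hN⟩ := hnc
    have claim : ∀ k : ℕ, ∃ (n : ℕ) (g : Ω → ℂ), Measurable g ∧ (∀ x, ‖g x‖ ≤ ‖f x‖) ∧
        (∀ x, (n : ℝ) < ‖f x‖ → g x = 0) ∧ k * ε ^ 2 ≤ ‖T g‖ ^ 2 := by
      intro k
      induction k with
      | zero => exact ⟨0, 0, measurable_zero, by simp, by simp, by simp⟩
      | succ k ih =>
        obtain ⟨n, g, hgm, hgf, hg0, hgT⟩ := ih
        obtain ⟨p, m, hnp, hpm, hd⟩ : ∃ p m : ℕ, n ≤ p ∧ p ≤ m ∧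
            ε ≤ dist (T (trunc f m)) (T (trunc f p)) := by
          obtain ⟨m, hm, p, hp, hd⟩ := hN n
          rcases le_total p m with h | h
          · exact ⟨p, m, hp, h, hd⟩
          · exact ⟨m, p, hm, h, by rwa [dist_comm]⟩
        set d : Ω → ℂ := fun x => (-1) * trunc f p x + trunc f m x with hddef
        have hdm : Measurable d := (trunc_measurable hf p).linear (trunc_measurable hf m) _
        have hdb : Bdd d := (trunc_bdd f p).linear (trunc_bdd f m) _
        have hTd : T d = T (trunc f m) - T (trunc f p) := by
          rw [hddef, linear_of_inner_eq_cintegral hT (trunc_measurable hf p)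
            (trunc_measurable hf m) (trunc_bdd f p) (trunc_bdd f m)]
          simp [neg_add_eq_sub]
        have hpm' : (p : ℝ) ≤ m := by exact_mod_cast hpm
        have hnp' : (n : ℝ) ≤ p := by exact_mod_cast hnp
        have hgb : Bdd g := ⟨n, fun x => by
          by_cases hx : (n : ℝ) < ‖f x‖
          · simp [hg0 x hx]
          · exact (hgf x).trans (not_lt.1 hx)⟩
        have hnew : ∀ c : ℂ, ‖c‖ = 1 →
            (∀ x, ‖c * d x + g x‖ ≤ ‖f x‖) ∧ ∀ x, (m : ℝ) < ‖f x‖ → c * d x + g x = 0 := by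
          refine fun c hc => ⟨fun x => ?_, fun x hx => ?_⟩
          · by_cases h1 : ‖f x‖ ≤ p
            · simpa [hddef, trunc, h1, h1.trans hpm'] using hgf x
            · have h2 := hg0 x (hnp'.trans_lt (not_le.1 h1))
              by_cases h3 : ‖f x‖ ≤ m <;> simp [hddef, trunc, h1, h2, h3, hc]
          · have h1 : ¬ ‖f x‖ ≤ p := not_le.2 (hpm'.trans_lt hx)
            simp [hddef, trunc, h1, not_le.2 hx, hg0 x (hnp'.trans_lt (not_le.1 h1))]
        have hεd : ε ^ 2 ≤ ‖T d‖ ^ 2 := by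
          rw [hTd, ← dist_eq_norm]
          exact pow_le_pow_left₀ hε.le hd 2
        have hpar := parallelogram_law_with_norm ℂ (T g) (T d)
        have e1 := linear_of_inner_eq_cintegral hT hdm hgm hdb hgb 1
        have e2 := linear_of_inner_eq_cintegral hT hdm hgm hdb hgb (-1)
        rw [one_smul, add_comm (T d)] at e1
        rw [neg_one_smul, neg_add_eq_sub] at e2
        by_cases hbig : ((k + 1 : ℕ) : ℝ) * ε ^ 2 ≤ ‖T g + T d‖ ^ 2
        · obtain ⟨ha, hb⟩ := hnew 1 (by simp)
          exact ⟨m, _, hdm.linear hgm 1, ha, hb, by rwa [e1]⟩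
        · obtain ⟨ha, hb⟩ := hnew (-1) (by simp)
          refine ⟨m, _, hdm.linear hgm (-1), ha, hb, ?_⟩
          rw [e2]
          push_cast at hbig ⊢
          nlinarith
    obtain ⟨k, hk⟩ := exists_nat_gt (M ^ 2 / ε ^ 2)
    obtain ⟨n, g, hgm, hgf, hg0, hgT⟩ := claim k
    have h1 : ‖T g‖ ≤ M := hM g hgm ⟨n, fun x => by
      by_cases hx : (n : ℝ) < ‖f x‖
      · simp [hg0 x hx]
      · exact (hgf x).trans (not_lt.1 hx)⟩ hgf
    rw [div_lt_iff₀ (by positivity)] at hk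
    nlinarith [pow_le_pow_left₀ (norm_nonneg (T g)) h1 2]
  obtain ⟨η, hη⟩ := cauchySeq_tendsto_of_complete hc
  refine ⟨η, hη, fun ψ => tendsto_nhds_unique (tendsto_const_nhds.inner hη) ?_⟩
  simp_rw [fun n => hT _ (trunc_measurable hf n) (trunc_bdd f n) ψ]
  exact (N ψ).tendsto_cintegral_trunc hf (hi ψ)

theorem forall_cIntegrable_iff [CompleteSpace H] {T : (Ω → ℂ) → H} {N : H → ComplexMeasure Ω}
    (hT : ∀ g, Measurable g → Bdd g → ∀ ψ, ⟪ψ, T g⟫ = (N ψ).cintegral g) {f : Ω → ℂ}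
    (hf : Measurable f) :
    (∀ ψ, (N ψ).CIntegrable f) ↔ ∀ B, MeasurableSet B →
      ∃ η, Tendsto (fun n => T (B.indicator (trunc f n))) atTop (𝓝 η) := by
  constructor
  · intro hi B hB
    obtain ⟨η, hη, -⟩ := exists_tendsto_trunc hT (hf.indicator hB)
      fun ψ => Integrable.indicator (hi ψ) hB
    simp_rw [trunc_indicator] at hη
    exact ⟨η, hη⟩
  · intro h ψ
    refine (N ψ).cIntegrable_of_tendsto hf fun B hB => ?_
    obtain ⟨η, hη⟩ := h B hB
    refine ⟨⟪ψ, η⟫, (tendsto_const_nhds.inner hη).congr fun n => ?_⟩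
    exact hT _ ((trunc_measurable hf n).indicator hB)
      ((trunc_bdd f n).of_le fun x => norm_indicator_le_norm_self _ _) ψ

end Representation

section Operators

variable {Ω : Type*} [MeasurableSpace Ω] {H : Type*} [NormedAddCommGroup H]
  [InnerProductSpace ℂ H]

open Classical in
/-- The value of a partially defined operator, extended by `0` outside its domain. -/
def LinearPMap.app (A : H →ₗ.[ℂ] H) (φ : H) : H := if h : φ ∈ A.domain then A ⟨φ, h⟩ else 0

theorem LinearPMap.app_eq (A : H →ₗ.[ℂ] H) {φ : H} (h : φ ∈ A.domain) : A ⟨φ, h⟩ = A.app φ := by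
  simp [LinearPMap.app, h]

/-- An everywhere defined operator as a linear map. -/
def LinearPMap.appLin (A : H →ₗ.[ℂ] H) (hA : A.domain = ⊤) : H →ₗ[ℂ] H where
  toFun := A.app
  map_add' φ ψ := by
    have h : ∀ φ, φ ∈ A.domain := fun φ => hA ▸ Submodule.mem_top
    rw [← A.app_eq (h φ), ← A.app_eq (h ψ), ← A.app_eq (h (φ + ψ)), ← A.map_add]
    rfl
  map_smul' c φ := by
    have h : ∀ φ, φ ∈ A.domain := fun φ => hA ▸ Submodule.mem_top
    rw [← A.app_eq (h φ), ← A.app_eq (h (c • φ)), RingHom.id_apply, ← A.map_smul]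
    rfl

theorem LinearPMap.appLin_apply (A : H →ₗ.[ℂ] H) (hA : A.domain = ⊤) (φ : H) :
    A.appLin hA φ = A.app φ := rfl

theorem inner_polarization_right (T : H →ₗ[ℂ] H) (ψ φ : H) :
    ⟪ψ, T φ⟫ = (⟪ψ + φ, T (ψ + φ)⟫ - ⟪ψ - φ, T (ψ - φ)⟫
      - Complex.I * ⟪ψ + Complex.I • φ, T (ψ + Complex.I • φ)⟫
      + Complex.I * ⟪ψ - Complex.I • φ, T (ψ - Complex.I • φ)⟫) / 4 := by
  simp only [map_add, map_sub, map_smul, inner_add_left, inner_add_right, inner_sub_left,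
    inner_sub_right, inner_smul_left, inner_smul_right, Complex.conj_I]
  linear_combination (⟪ψ, T φ⟫ / 2 - ⟪φ, T ψ⟫ / 2) * Complex.I_sq

theorem tendsto_inner_of_diag {T : ℕ → H →ₗ[ℂ] H} {S : H →ₗ[ℂ] H}
    (h : ∀ φ, Tendsto (fun n => ⟪φ, T n φ⟫) atTop (𝓝 ⟪φ, S φ⟫)) (ψ φ : H) :
    Tendsto (fun n => ⟪ψ, T n φ⟫) atTop (𝓝 ⟪ψ, S φ⟫) := by
  rw [inner_polarization_right S]
  simp_rw [fun n => inner_polarization_right (T n) ψ φ]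
  exact ((((h _).sub (h _)).sub ((h _).const_mul _)).add ((h _).const_mul _)).div_const _

theorem hasSum_inner_of_diag {T : ℕ → H →ₗ[ℂ] H} {S : H →ₗ[ℂ] H}
    (h : ∀ φ, HasSum (fun n => ⟪φ, T n φ⟫) ⟪φ, S φ⟫) (ψ φ : H) :
    HasSum (fun n => ⟪ψ, T n φ⟫) ⟪ψ, S φ⟫ := by
  rw [inner_polarization_right S]
  simp_rw [fun n => inner_polarization_right (T n) ψ φ]
  exact ((((h _).sub (h _)).sub ((h _).mul_left _)).add ((h _).mul_left _)).div_const _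

/-- `ν` represents `Γ` on bounded measurable functions. -/
structure BddRepresents (Γ : (Ω → ℂ) → (H →ₗ.[ℂ] H)) (ν : H → H → ComplexMeasure Ω) : Prop where
  domain_eq_top : ∀ f, Measurable f → Bdd f → (Γ f).domain = ⊤
  inner_app : ∀ φ f, Measurable f → Bdd f → ∀ ψ, ⟪ψ, (Γ f).app φ⟫ = (ν ψ φ).cintegral f

namespace BddRepresents

variable {Γ : (Ω → ℂ) → (H →ₗ.[ℂ] H)} {ν : H → H → ComplexMeasure Ω}

theorem mem_domain (hR : BddRepresents Γ ν) {f : Ω → ℂ} (hf : Measurable f) (hb : Bdd f) (φ : H) :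
    φ ∈ (Γ f).domain := hR.domain_eq_top f hf hb ▸ Submodule.mem_top

theorem app_linear (hR : BddRepresents Γ ν) {f g : Ω → ℂ} (hf : Measurable f) (hg : Measurable g)
    (hfb : Bdd f) (hgb : Bdd g) (c : ℂ) (φ : H) :
    (Γ (fun x => c * f x + g x)).app φ = c • (Γ f).app φ + (Γ g).app φ :=
  linear_of_inner_eq_cintegral (T := fun f => (Γ f).app φ) (hR.inner_app φ) hf hg hfb hgb c

theorem nonneg (hR : BddRepresents Γ ν)
    (hν : ∀ φ B, MeasurableSet B → 0 ≤ (ν φ φ B).re ∧ (ν φ φ B).im = 0)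
    {f : Ω → ℝ} (hf : Measurable f) (h0 : ∀ x, 0 ≤ f x) (hb : Bdd (fun x => (f x : ℂ))) (φ : H) :
    0 ≤ ⟪φ, (Γ (fun x => (f x : ℂ))).app φ⟫.re ∧ ⟪φ, (Γ (fun x => (f x : ℂ))).app φ⟫.im = 0 := by
  rw [hR.inner_app φ _ (Measurable.complex_ofReal hf) hb]
  have := (ν φ φ).cintegral_nonneg (fun B hB => Complex.nonneg_iff.2
    ⟨(hν φ B hB).1, (hν φ B hB).2.symm⟩) hf h0 hb
  exact ⟨(Complex.nonneg_iff.1 this).1, (Complex.nonneg_iff.1 this).2.symm⟩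

theorem exists_bound [CompleteSpace H] (hR : BddRepresents Γ ν)
    (hν : ∀ φ B, MeasurableSet B → 0 ≤ (ν φ φ B).re ∧ (ν φ φ B).im = 0)
    {f : Ω → ℂ} (hf : Measurable f) (hb : Bdd f) : ∃ C : ℝ, ∀ φ, ‖(Γ f).app φ‖ ≤ C * ‖φ‖ := by
  refine bdd_induction (P := fun f => ∃ C : ℝ, ∀ φ, ‖(Γ f).app φ‖ ≤ C * ‖φ‖) ?_ ?_ hf hb
  · rintro c f g hf hg hfb hgb ⟨C, hC⟩ ⟨D, hD⟩
    refine ⟨‖c‖ * C + D, fun φ => ?_⟩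
    rw [hR.app_linear hf hg hfb hgb]
    refine (norm_add_le _ _).trans ?_
    rw [norm_smul, add_mul, mul_assoc]
    exact add_le_add (mul_le_mul_of_nonneg_left (hC φ) (norm_nonneg _)) (hD φ)
  · intro f hf h0 hb
    have hdom := hR.domain_eq_top _ (Measurable.complex_ofReal hf) hb
    have hsym : ((Γ fun x => (f x : ℂ)).appLin hdom).IsSymmetric := by
      rw [LinearMap.isSymmetric_iff_inner_map_self_real]
      intro φ
      rw [inner_conj_symm, ← inner_conj_symm _ φ]
      exact (Complex.conj_eq_iff_im.2 (hR.nonneg hν hf h0 hb φ).2).symm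
    exact ⟨_, ContinuousLinearMap.le_opNorm (⟨_, hsym.continuous⟩ : H →L[ℂ] H)⟩

theorem mem_domain_iff [CompleteSpace H] (hR : BddRepresents Γ ν) {f : Ω → ℂ} (hf : Measurable f)
    (φ : H) :
    (∀ ψ, (ν ψ φ).CIntegrable f) ↔ ∀ B : Set Ω, MeasurableSet B →
      ∀ h : ∀ n : ℕ, φ ∈ (Γ (B.indicator (trunc f n))).domain,
        ∃ η : H, Tendsto (fun n => Γ (B.indicator (trunc f n)) ⟨φ, h n⟩) atTop (𝓝 η) := by
  rw [forall_cIntegrable_iff (T := fun f => (Γ f).app φ) (N := fun ψ => ν ψ φ) (hR.inner_app φ) hf]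
  refine forall₂_congr fun B hB => ?_
  have hd : ∀ n : ℕ, φ ∈ (Γ (B.indicator (trunc f n))).domain := fun n =>
    hR.mem_domain ((trunc_measurable hf n).indicator hB)
      ((trunc_bdd f n).of_le fun x => norm_indicator_le_norm_self _ _) φ
  simp only [LinearPMap.app_eq, hd, implies_true, forall_const]

end BddRepresents

theorem operatorMeasure_unique {Γ : (Ω → ℂ) → (H →ₗ.[ℂ] H)} {E E' : Set Ω → H →L[ℂ] H}
    {ν ν' : H → H → ComplexMeasure Ω} (hR : BddRepresents Γ ν) (hR' : BddRepresents Γ ν')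
    (hE : ∀ (ψ φ : H) (B : Set Ω), MeasurableSet B → ν ψ φ B = ⟪ψ, E B φ⟫)
    (hE' : ∀ (ψ φ : H) (B : Set Ω), MeasurableSet B → ν' ψ φ B = ⟪ψ, E' B φ⟫)
    {B : Set Ω} (hB : MeasurableSet B) : E' B = E B := by
  ext φ
  refine ext_inner_left ℂ fun ψ => ?_
  have hm : Measurable (B.indicator (1 : Ω → ℂ)) := measurable_one.indicator hB
  rw [← hE ψ φ B hB, ← hE' ψ φ B hB, ← (ν ψ φ).cintegral_indicator_one hB,
    ← (ν' ψ φ).cintegral_indicator_one hB, ← hR.inner_app φ _ hm (bdd_indicator_one B),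
    ← hR'.inner_app φ _ hm (bdd_indicator_one B)]

theorem bddRepresents_of_forall {Γ : (Ω → ℂ) → (H →ₗ.[ℂ] H)} {ν : H → H → ComplexMeasure Ω}
    (h : ∀ f : Ω → ℂ, Measurable f →
      ((Γ f).domain : Set H) = {φ : H | ∀ ψ : H, (ν ψ φ).CIntegrable f} ∧
      ∀ (φ : (Γ f).domain) (ψ : H), ⟪ψ, Γ f φ⟫ = (ν ψ (φ : H)).cintegral f) :
    BddRepresents Γ ν := by
  have hd : ∀ f, Measurable f → Bdd f → (Γ f).domain = ⊤ := fun f hf hb => by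
    refine Submodule.eq_top_iff'.2 fun φ => ?_
    rw [← SetLike.mem_coe, (h f hf).1]
    exact fun ψ => Bdd.integrable hf hb
  refine ⟨hd, fun φ f hf hb ψ => ?_⟩
  rw [← (Γ f).app_eq (hd f hf hb ▸ Submodule.mem_top)]
  exact (h f hf).2 _ ψ

end Operators

section Construction

variable {Ω : Type*} [MeasurableSpace Ω] {H : Type*} [NormedAddCommGroup H]
  [InnerProductSpace ℂ H]

theorem re_inner_app_mono {Γ : (Ω → ℂ) → (H →ₗ.[ℂ] H)}
    (hlin : ∀ f g, Measurable f → Measurable g → Bdd f → Bdd g → ∀ (c : ℂ) (φ : H),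
      (Γ (fun x => c * f x + g x)).app φ = c • (Γ f).app φ + (Γ g).app φ)
    (hpos : ∀ f : Ω → ℝ, Measurable f → (∀ x, 0 ≤ f x) → Bdd (fun x => (f x : ℂ)) → ∀ φ : H,
      0 ≤ ⟪φ, (Γ (fun x => (f x : ℂ))).app φ⟫.re ∧ ⟪φ, (Γ (fun x => (f x : ℂ))).app φ⟫.im = 0)
    {f g : Ω → ℝ} (hf : Measurable f) (hg : Measurable g)
    (hfb : Bdd (fun x => (f x : ℂ))) (hgb : Bdd (fun x => (g x : ℂ))) (hle : ∀ x, f x ≤ g x)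
    (φ : H) :
    ⟪φ, (Γ (fun x => (f x : ℂ))).app φ⟫.re ≤ ⟪φ, (Γ (fun x => (g x : ℂ))).app φ⟫.re := by
  have e : (fun x => ((g x - f x : ℝ) : ℂ)) = fun x => (-1) * (f x : ℂ) + (g x : ℂ) := by
    funext x; push_cast; ring
  have h := (hpos (fun x => g x - f x) (hg.sub hf) (fun x => sub_nonneg.2 (hle x))
    (e ▸ hfb.linear hgb (-1)) φ).1
  rw [e, hlin _ _ (Measurable.complex_ofReal hf) (Measurable.complex_ofReal hg)
    hfb hgb, neg_one_smul, inner_add_right, inner_neg_right, Complex.add_re, Complex.neg_re] at h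
  linarith

theorem bdd_of_monotone_of_tendsto {Ω : Type*} {F : ℕ → Ω → ℝ} {f : Ω → ℝ} (h0 : ∀ n x, 0 ≤ F n x)
    (hmono : ∀ x, Monotone fun n => F n x)
    (hlim : ∀ x, Tendsto (fun n => F n x) atTop (𝓝 (f x))) (hb : Bdd (fun x => (f x : ℂ)))
    (n : ℕ) : Bdd (fun x => (F n x : ℂ)) := hb.of_le fun x => by
  rw [Complex.norm_real, Complex.norm_real, Real.norm_of_nonneg (h0 n x)]
  exact ((hmono x).ge_of_tendsto (hlim x) n).trans (le_abs_self _)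

/-- A positive linear map from bounded measurable functions to everywhere defined operators
that is compatible with bounded monotone limits. -/
structure MonotoneCalculus (Γ : (Ω → ℂ) → (H →ₗ.[ℂ] H)) : Prop where
  domain_eq_top : ∀ f, Measurable f → Bdd f → (Γ f).domain = ⊤
  app_linear : ∀ f g, Measurable f → Measurable g → Bdd f → Bdd g → ∀ (c : ℂ) (φ : H),
    (Γ (fun x => c * f x + g x)).app φ = c • (Γ f).app φ + (Γ g).app φ
  nonneg : ∀ f : Ω → ℝ, Measurable f → (∀ x, 0 ≤ f x) → Bdd (fun x => (f x : ℂ)) → ∀ φ : H,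
    0 ≤ ⟪φ, (Γ (fun x => (f x : ℂ))).app φ⟫.re ∧ ⟪φ, (Γ (fun x => (f x : ℂ))).app φ⟫.im = 0
  iSup_eq : ∀ (F : ℕ → Ω → ℝ) (f : Ω → ℝ), (∀ n, Measurable (F n)) → (∀ n x, 0 ≤ F n x) →
    (∀ x, Monotone fun n => F n x) → (∀ x, Tendsto (fun n => F n x) atTop (𝓝 (f x))) →
    Measurable f → Bdd (fun x => (f x : ℂ)) → ∀ φ : H,
    (⨆ n : ℕ, ⟪φ, (Γ (fun x => (F n x : ℂ))).app φ⟫.re) = ⟪φ, (Γ (fun x => (f x : ℂ))).app φ⟫.re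

namespace MonotoneCalculus

variable {Γ : (Ω → ℂ) → (H →ₗ.[ℂ] H)}

theorem app_zero (hΓ : MonotoneCalculus Γ) (φ : H) : (Γ 0).app φ = 0 := by
  have h := hΓ.app_linear 0 0 measurable_zero measurable_zero ⟨0, by simp⟩ ⟨0, by simp⟩ (-1) φ
  have e : (fun x => -1 * (0 : Ω → ℂ) x + (0 : Ω → ℂ) x) = 0 := by funext x; simp
  rw [e] at h
  simpa using h

theorem mono (hΓ : MonotoneCalculus Γ) {f g : Ω → ℝ} (hf : Measurable f) (hg : Measurable g)
    (hfb : Bdd (fun x => (f x : ℂ))) (hgb : Bdd (fun x => (g x : ℂ))) (hle : ∀ x, f x ≤ g x)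
    (φ : H) :
    ⟪φ, (Γ (fun x => (f x : ℂ))).app φ⟫.re ≤ ⟪φ, (Γ (fun x => (g x : ℂ))).app φ⟫.re :=
  re_inner_app_mono hΓ.app_linear hΓ.nonneg hf hg hfb hgb hle φ

theorem tendsto_inner (hΓ : MonotoneCalculus Γ) {F : ℕ → Ω → ℝ} {f : Ω → ℝ}
    (hF : ∀ n, Measurable (F n)) (h0 : ∀ n x, 0 ≤ F n x) (hmono : ∀ x, Monotone fun n => F n x)
    (hlim : ∀ x, Tendsto (fun n => F n x) atTop (𝓝 (f x))) (hf : Measurable f)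
    (hb : Bdd (fun x => (f x : ℂ))) (ψ φ : H) :
    Tendsto (fun n => ⟪ψ, (Γ (fun x => (F n x : ℂ))).app φ⟫) atTop
      (𝓝 ⟪ψ, (Γ (fun x => (f x : ℂ))).app φ⟫) := by
  have hle : ∀ n x, F n x ≤ f x := fun n x => (hmono x).ge_of_tendsto (hlim x) n
  have hf0 : ∀ x, 0 ≤ f x := fun x => (h0 0 x).trans (hle 0 x)
  have hFb := bdd_of_monotone_of_tendsto h0 hmono hlim hb
  have hd : ∀ n, (Γ (fun x => (F n x : ℂ))).domain = ⊤ := fun n =>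
    hΓ.domain_eq_top _ (Measurable.complex_ofReal (hF n)) (hFb n)
  refine tendsto_inner_of_diag (T := fun n => (Γ (fun x => (F n x : ℂ))).appLin (hd n))
    (S := (Γ (fun x => (f x : ℂ))).appLin
      (hΓ.domain_eq_top _ (Measurable.complex_ofReal hf) hb)) (fun φ => ?_) ψ φ
  simp only [LinearPMap.appLin_apply]
  have hreal : ∀ z : ℂ, z.im = 0 → z = (z.re : ℂ) := fun z hz => by
    apply Complex.ext <;> simp [hz]
  rw [hreal _ (hΓ.nonneg f hf hf0 hb φ).2]
  refine Tendsto.congr (fun n => (hreal _ (hΓ.nonneg (F n) (hF n) (h0 n) (hFb n) φ).2).symm)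
    ((Complex.continuous_ofReal.tendsto _).comp ?_)
  rw [← hΓ.iSup_eq F f hF h0 hmono hlim hf hb φ]
  refine tendsto_atTop_ciSup
    (fun m n hmn => hΓ.mono (hF m) (hF n) (hFb m) (hFb n) (fun x => hmono x hmn) φ)
    ⟨⟪φ, (Γ (fun x => (f x : ℂ))).app φ⟫.re, ?_⟩
  rintro _ ⟨n, rfl⟩
  exact hΓ.mono (hF n) hf (hFb n) hb (hle n) φ

theorem hasSum_indicator (hΓ : MonotoneCalculus Γ) {A : ℕ → Set Ω} (hA : ∀ i, MeasurableSet (A i))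
    (hdisj : Pairwise (Function.onFun Disjoint A)) (ψ φ : H) :
    HasSum (fun i => ⟪ψ, (Γ ((A i).indicator 1)).app φ⟫)
      ⟪ψ, (Γ ((⋃ i, A i).indicator 1)).app φ⟫ := by
  have hm : ∀ {B : Set Ω}, MeasurableSet B → Measurable (B.indicator (1 : Ω → ℂ)) :=
    fun hB => measurable_one.indicator hB
  have hcast : ∀ B : Set Ω, B.indicator (1 : Ω → ℂ)
      = fun x => ((B.indicator (fun _ => (1 : ℝ)) x : ℝ) : ℂ) := fun B => by
    funext x
    by_cases hx : x ∈ B <;> simp [hx]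
  have hU : MeasurableSet (⋃ i, A i) := MeasurableSet.iUnion hA
  have hpartial : ∀ (n : ℕ) (φ : H), (Γ ((⋃ i < n, A i).indicator 1)).app φ
      = ∑ i ∈ Finset.range n, (Γ ((A i).indicator 1)).app φ := by
    intro n φ
    induction n with
    | zero =>
      have e : (⋃ i < 0, A i) = ∅ := by simp
      rw [e, Set.indicator_empty', hΓ.app_zero, Finset.sum_range_zero]
    | succ n ih =>
      have e : ((⋃ i < n + 1, A i).indicator (1 : Ω → ℂ))
          = fun x => 1 * (A n).indicator 1 x + (⋃ i < n, A i).indicator 1 x := by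
        have hd : Disjoint (⋃ i < n, A i) (A n) := by
          simp only [Set.disjoint_iUnion_left]
          exact fun i hi => hdisj hi.ne
        rw [Set.biUnion_lt_succ, Set.indicator_union_of_disjoint hd]
        funext x
        rw [one_mul, add_comm]
      rw [e, hΓ.app_linear _ _ (hm (hA n))
        (hm (MeasurableSet.iUnion fun i => MeasurableSet.iUnion fun _ => hA i))
        (bdd_indicator_one _) (bdd_indicator_one _), ih, one_smul, Finset.sum_range_succ, add_comm]
  have hd : ∀ {B : Set Ω}, MeasurableSet B → (Γ (B.indicator 1)).domain = ⊤ := fun hB =>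
    hΓ.domain_eq_top _ (hm hB) (bdd_indicator_one _)
  refine hasSum_inner_of_diag (T := fun i => (Γ ((A i).indicator 1)).appLin (hd (hA i)))
    (S := (Γ ((⋃ i, A i).indicator 1)).appLin (hd hU)) (fun φ => ?_) ψ φ
  simp only [LinearPMap.appLin_apply]
  have hlim : Tendsto (fun n => ∑ i ∈ Finset.range n, ⟪φ, (Γ ((A i).indicator 1)).app φ⟫) atTop
      (𝓝 ⟪φ, (Γ ((⋃ i, A i).indicator 1)).app φ⟫) := by
    have h := hΓ.tendsto_inner (F := fun n => (⋃ i < n, A i).indicator fun _ => 1)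
      (f := (⋃ i, A i).indicator fun _ => 1)
      (fun n => measurable_const.indicator
        (MeasurableSet.iUnion fun i => MeasurableSet.iUnion fun _ => hA i))
      (fun n x => Set.indicator_nonneg (fun _ _ => zero_le_one) x)
      (fun x m n hmn => Set.indicator_le_indicator_of_subset
        (Set.biUnion_subset_biUnion_left fun i hi => lt_of_lt_of_le hi hmn)
        (fun _ => zero_le_one) x)
      (fun x => ?_) (measurable_const.indicator hU) (hcast _ ▸ bdd_indicator_one _) φ φ
    · simp_rw [← hcast, hpartial, inner_sum] at h
      exact h
    · by_cases hx : x ∈ ⋃ i, A i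
      · obtain ⟨i, hi⟩ := Set.mem_iUnion.1 hx
        refine tendsto_const_nhds.congr' ?_
        filter_upwards [eventually_gt_atTop i] with n hn
        have : x ∈ ⋃ i < n, A i := Set.mem_biUnion (show i ∈ {i | i < n} from hn) hi
        rw [Set.indicator_of_mem hx, Set.indicator_of_mem this]
      · have : ∀ n, x ∉ ⋃ i < n, A i := fun n h => hx (by
          obtain ⟨i, _, hi⟩ := Set.mem_iUnion₂.1 h
          exact Set.mem_iUnion.2 ⟨i, hi⟩)
        simp only [Set.indicator_of_notMem hx, Set.indicator_of_notMem (this _),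
          tendsto_const_nhds]
  have hreal : ∀ B, MeasurableSet B → 0 ≤ ⟪φ, (Γ (B.indicator 1)).app φ⟫.re ∧
      ⟪φ, (Γ (B.indicator 1)).app φ⟫ = (⟪φ, (Γ (B.indicator 1)).app φ⟫.re : ℂ) := by
    intro B hB
    have h := hΓ.nonneg (B.indicator fun _ => 1) (measurable_const.indicator hB)
      (fun x => Set.indicator_nonneg (fun _ _ => zero_le_one) x) (hcast B ▸ bdd_indicator_one B) φ
    rw [← hcast] at h
    exact ⟨h.1, by apply Complex.ext <;> simp [h.2]⟩
  have hre := (Complex.continuous_re.tendsto _).comp hlim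
  have hs := (hasSum_iff_tendsto_nat_of_nonneg (fun i => (hreal (A i) (hA i)).1) _).2
    (hre.congr fun n => by simp)
  rw [(hreal _ hU).2]
  convert Complex.hasSum_ofReal.2 hs using 1
  funext i
  exact (hreal (A i) (hA i)).2

theorem exists_bddRepresents (hΓ : MonotoneCalculus Γ)
    (hbound : ∀ f, Measurable f → Bdd f → ∃ C : ℝ, ∀ φ, ‖(Γ f).app φ‖ ≤ C * ‖φ‖) :
    ∃ (E : Set Ω → H →L[ℂ] H) (ν : H → H → ComplexMeasure Ω),
      (∀ B : Set Ω, MeasurableSet B → (E B).IsPositive) ∧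
      (∀ (ψ φ : H) (B : Set Ω), MeasurableSet B → ν ψ φ B = ⟪ψ, E B φ⟫) ∧ BddRepresents Γ ν := by
  classical
  have hm : ∀ {B : Set Ω}, MeasurableSet B → Measurable (B.indicator (1 : Ω → ℂ)) :=
    fun hB => measurable_one.indicator hB
  have hEx : ∀ B : Set Ω, ∃ A : H →L[ℂ] H,
      (MeasurableSet B → ∀ φ, A φ = (Γ (B.indicator 1)).app φ) ∧ (¬ MeasurableSet B → A = 0) := by
    intro B
    by_cases hB : MeasurableSet B
    · obtain ⟨C, hC⟩ := hbound _ (hm hB) (bdd_indicator_one B)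
      exact ⟨((Γ (B.indicator 1)).appLin
        (hΓ.domain_eq_top _ (hm hB) (bdd_indicator_one B))).mkContinuous C hC,
        fun _ _ => rfl, fun h => absurd hB h⟩
    · exact ⟨0, fun h => absurd h hB, fun _ => rfl⟩
  choose E hE hE0 using hEx
  let ν : H → H → ComplexMeasure Ω := fun ψ φ =>
    { measureOf' := fun B => ⟪ψ, E B φ⟫
      empty' := by
        rw [hE ∅ MeasurableSet.empty, Set.indicator_empty', hΓ.app_zero, inner_zero_right]
      not_measurable' := fun B hB => by simp [hE0 B hB]
      m_iUnion' := fun A hA hd => by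
        simp_rw [fun i => hE (A i) (hA i) φ, hE _ (MeasurableSet.iUnion hA) φ]
        exact hΓ.hasSum_indicator hA hd ψ φ }
  have hν : ∀ (ψ φ : H) (B : Set Ω), ν ψ φ B = ⟪ψ, E B φ⟫ := fun _ _ _ => rfl
  refine ⟨E, ν, fun B hB => ?_, fun ψ φ B _ => hν ψ φ B, hΓ.domain_eq_top, fun φ f hf hb ψ => ?_⟩
  · have h : ∀ φ, 0 ≤ ⟪φ, E B φ⟫.re ∧ ⟪φ, E B φ⟫.im = 0 := by
      intro φ
      have hcast : B.indicator (1 : Ω → ℂ)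
          = fun x => ((B.indicator (fun _ => (1 : ℝ)) x : ℝ) : ℂ) := by
        funext x
        by_cases hx : x ∈ B <;> simp [hx]
      rw [hE B hB, hcast]
      exact hΓ.nonneg _ (measurable_const.indicator hB)
        (fun x => Set.indicator_nonneg (fun _ _ => zero_le_one) x)
        (hcast ▸ bdd_indicator_one B) φ
    refine (ContinuousLinearMap.isPositive_iff_complex _).2 fun φ => ?_
    have e : ⟪E B φ, φ⟫ = ⟪φ, E B φ⟫ := by
      rw [← inner_conj_symm]
      exact Complex.conj_eq_iff_im.2 (h φ).2
    rw [e]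
    exact ⟨Complex.ext rfl (h φ).2.symm, (h φ).1⟩
  · refine bdd_induction (P := fun f => ⟪ψ, (Γ f).app φ⟫ = (ν ψ φ).cintegral f) ?_ ?_ hf hb
    · intro c f g hf hg hfb hgb hPf hPg
      rw [hΓ.app_linear f g hf hg hfb hgb, inner_add_right, inner_smul_right, hPf, hPg,
        (ν ψ φ).cintegral_linear (Bdd.integrable hf hfb) (Bdd.integrable hg hgb)]
    · intro f hf h0 hb
      refine bdd_nonneg_induction (P := fun f => ⟪ψ, (Γ (fun x => (f x : ℂ))).app φ⟫
        = (ν ψ φ).cintegral (fun x => (f x : ℂ))) ?_ ?_ ?_ hf h0 hb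
      · intro c _ B hB
        rw [indicator_const_eq, hΓ.app_linear _ _ (hm hB) measurable_zero (bdd_indicator_one B)
          ⟨0, by simp⟩, hΓ.app_zero, add_zero, inner_smul_right, (ν ψ φ).cintegral_linear
          (Bdd.integrable (hm hB) (bdd_indicator_one B)) (integrable_zero _ _ _),
          (ν ψ φ).cintegral_indicator_one hB, (ν ψ φ).cintegral_zero, hν, hE B hB, add_zero]
      · intro f g hf hg hfb hgb hPf hPg
        have hf' := Measurable.complex_ofReal hf
        have hg' := Measurable.complex_ofReal hg
        rw [ofReal_add_eq, hΓ.app_linear _ _ hf' hg' hfb hgb, (ν ψ φ).cintegral_linear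
          (Bdd.integrable hf' hfb) (Bdd.integrable hg' hgb), one_mul, one_smul, inner_add_right,
          hPf, hPg]
      · intro F f hF h0 hmono hlim hf hb hP
        exact tendsto_nhds_unique
          ((hΓ.tendsto_inner hF h0 hmono hlim hf hb ψ φ).congr hP)
          ((ν ψ φ).tendsto_cintegral_of_monotone hF h0 hmono hlim hf hb)

end MonotoneCalculus

theorem BddRepresents.monotoneCalculus {Γ : (Ω → ℂ) → (H →ₗ.[ℂ] H)}
    {ν : H → H → ComplexMeasure Ω} (hR : BddRepresents Γ ν)
    (hν : ∀ φ B, MeasurableSet B → 0 ≤ (ν φ φ B).re ∧ (ν φ φ B).im = 0) :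
    MonotoneCalculus Γ where
  domain_eq_top := hR.domain_eq_top
  app_linear _ _ hf hg hfb hgb c φ := hR.app_linear hf hg hfb hgb c φ
  nonneg _ hf h0 hb φ := hR.nonneg hν hf h0 hb φ
  iSup_eq F f hF h0 hmono hlim hf hb φ := by
    have hFb := bdd_of_monotone_of_tendsto h0 hmono hlim hb
    have hle : Monotone fun n => ⟪φ, (Γ (fun x => (F n x : ℂ))).app φ⟫.re := fun m n hmn =>
      re_inner_app_mono (fun _ _ hf hg hfb hgb c φ => hR.app_linear hf hg hfb hgb c φ)
        (fun _ hf h0 hb φ => hR.nonneg hν hf h0 hb φ) (hF m) (hF n) (hFb m) (hFb n)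
        (fun x => hmono x hmn) φ
    refine (isLUB_of_tendsto_atTop hle ?_).ciSup_eq
    have h := (ν φ φ).tendsto_cintegral_of_monotone hF h0 hmono hlim hf hb
    rw [← hR.inner_app φ _ (Measurable.complex_ofReal hf) hb] at h
    refine ((Complex.continuous_re.tendsto _).comp h).congr fun n => ?_
    rw [Function.comp_apply,
      ← hR.inner_app φ _ (Measurable.complex_ofReal (hF n)) (hFb n)]

end Construction

/-- A map `Γ` from measurable functions `f : Ω → ℂ` to (not necessarily
bounded) linear operators in `H` coincides with `f ↦ L(f,E)` for a (necessarily unique)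
positive operator measure `E` if and only if conditions (i)-(iv) hold. -/
theorem stmt5 {Ω : Type*} [MeasurableSpace Ω] {H : Type*} [NormedAddCommGroup H]
    [InnerProductSpace ℂ H] [CompleteSpace H]
    (Γ : (Ω → ℂ) → (H →ₗ.[ℂ] H)) :
    (∃ (E : Set Ω → H →L[ℂ] H) (ν : H → H → MeasureTheory.ComplexMeasure Ω),
      ((∀ B : Set Ω, MeasurableSet B → (E B).IsPositive) ∧
       (∀ (ψ φ : H) (B : Set Ω), MeasurableSet B → ν ψ φ B = ⟪ψ, E B φ⟫) ∧
       (∀ f : Ω → ℂ, Measurable f →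
         ((Γ f).domain : Set H) = {φ : H | ∀ ψ : H, (ν ψ φ).CIntegrable f} ∧
         ∀ (φ : (Γ f).domain) (ψ : H), ⟪ψ, Γ f φ⟫ = (ν ψ (φ : H)).cintegral f)) ∧
      -- the positive operator measure representing Γ is unique
      (∀ (E' : Set Ω → H →L[ℂ] H) (ν' : H → H → MeasureTheory.ComplexMeasure Ω),
        ((∀ B : Set Ω, MeasurableSet B → (E' B).IsPositive) ∧
         (∀ (ψ φ : H) (B : Set Ω), MeasurableSet B → ν' ψ φ B = ⟪ψ, E' B φ⟫) ∧
         (∀ f : Ω → ℂ, Measurable f →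
           ((Γ f).domain : Set H) = {φ : H | ∀ ψ : H, (ν' ψ φ).CIntegrable f} ∧
           ∀ (φ : (Γ f).domain) (ψ : H), ⟪ψ, Γ f φ⟫ = (ν' ψ (φ : H)).cintegral f)) →
        ∀ B : Set Ω, MeasurableSet B → E' B = E B))
    ↔
    -- (i) Γ restricted to bounded functions is a positive linear map with values in L(H)
    (((∀ f : Ω → ℂ, Measurable f → Bdd f → (Γ f).domain = ⊤) ∧
      (∀ f g : Ω → ℂ, Measurable f → Measurable g → Bdd f → Bdd g → ∀ c : ℂ,
        ∀ (φ : H) (hfg : φ ∈ (Γ (fun x => c * f x + g x)).domain)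
          (hf' : φ ∈ (Γ f).domain) (hg' : φ ∈ (Γ g).domain),
          Γ (fun x => c * f x + g x) ⟨φ, hfg⟩ = c • Γ f ⟨φ, hf'⟩ + Γ g ⟨φ, hg'⟩) ∧
      (∀ f : Ω → ℂ, Measurable f → Bdd f →
        ∃ C : ℝ, ∀ (φ : H) (h : φ ∈ (Γ f).domain), ‖Γ f ⟨φ, h⟩‖ ≤ C * ‖φ‖) ∧
      (∀ f : Ω → ℂ, Measurable f → Bdd f → (∀ x, 0 ≤ (f x).re ∧ (f x).im = 0) →
        ∀ (φ : H) (h : φ ∈ (Γ f).domain),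
          0 ≤ (⟪φ, Γ f ⟨φ, h⟩⟫).re ∧ (⟪φ, Γ f ⟨φ, h⟩⟫).im = 0)) ∧
    -- (ii) monotone convergence for increasing sequences with a bounded limit
    (∀ (F : ℕ → Ω → ℝ) (f : Ω → ℝ), (∀ n, Measurable (F n)) →
      (∀ n x, 0 ≤ F n x) → (∀ x, Monotone fun n => F n x) →
      (∀ x, Tendsto (fun n => F n x) atTop (𝓝 (f x))) →
      Measurable f → Bdd (fun x => (f x : ℂ)) →
      ∀ (φ : H) (hn : ∀ n : ℕ, φ ∈ (Γ (fun x => (F n x : ℂ))).domain)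
        (hf : φ ∈ (Γ (fun x => (f x : ℂ))).domain),
        (⨆ n : ℕ, (⟪φ, Γ (fun x => (F n x : ℂ)) ⟨φ, hn n⟩⟫).re) =
          (⟪φ, Γ (fun x => (f x : ℂ)) ⟨φ, hf⟩⟫).re) ∧
    -- (iii) the domain of Γ(f) consists of exactly those φ for which (Γ(χ_B·f̃ₙ)φ) converges
    (∀ f : Ω → ℂ, Measurable f → ∀ φ : H,
      φ ∈ (Γ f).domain ↔
        ∀ B : Set Ω, MeasurableSet B →
          ∀ h : ∀ n : ℕ, φ ∈ (Γ (B.indicator (trunc f n))).domain,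
            ∃ η : H, Tendsto (fun n => Γ (B.indicator (trunc f n)) ⟨φ, h n⟩) atTop (𝓝 η)) ∧
    -- (iv) (Γ(f̃ₙ)φ) converges to Γ(f)φ for φ in the domain of Γ(f)
    (∀ f : Ω → ℂ, Measurable f → ∀ (φ : H) (hφ : φ ∈ (Γ f).domain)
      (h : ∀ n : ℕ, φ ∈ (Γ (trunc f n)).domain),
      Tendsto (fun n => Γ (trunc f n) ⟨φ, h n⟩) atTop (𝓝 (Γ f ⟨φ, hφ⟩)))) := by
  constructor
  · rintro ⟨E, ν, ⟨hpos, hE, hΓ⟩, -⟩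
    have hR := bddRepresents_of_forall hΓ
    have hν : ∀ φ B, MeasurableSet B → 0 ≤ (ν φ φ B).re ∧ (ν φ φ B).im = 0 := by
      intro φ B hB
      rw [hE φ φ B hB]
      have h := (hpos B hB).inner_nonneg_right φ
      exact ⟨(RCLike.nonneg_iff.1 h).1, (RCLike.nonneg_iff.1 h).2⟩
    have hM := hR.monotoneCalculus hν
    refine ⟨⟨hM.domain_eq_top, ?_, ?_, ?_⟩, ?_, ?_, ?_⟩
    · intro f g hf hg hfb hgb c φ _ _ _
      simp only [LinearPMap.app_eq]
      exact hM.app_linear f g hf hg hfb hgb c φ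
    · intro f hf hb
      obtain ⟨C, hC⟩ := hR.exists_bound hν hf hb
      exact ⟨C, fun φ h => by rw [LinearPMap.app_eq]; exact hC φ⟩
    · intro f hf hb h0 φ h
      have e : f = fun x => ((f x).re : ℂ) := by
        funext x
        exact Complex.ext rfl (h0 x).2
      rw [LinearPMap.app_eq, e]
      exact hM.nonneg (fun x => (f x).re) (Complex.measurable_re.comp hf) (fun x => (h0 x).1)
        (e ▸ hb) φ
    · intro F f hF h0 hmono hlim hf hb φ _ _
      simp only [LinearPMap.app_eq]
      exact hM.iSup_eq F f hF h0 hmono hlim hf hb φ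
    · intro f hf φ
      rw [← hR.mem_domain_iff hf φ, ← SetLike.mem_coe, (hΓ f hf).1, Set.mem_ofPred_eq]
    · intro f hf φ hφ h
      have hi : ∀ ψ, (ν ψ φ).CIntegrable f := by
        rw [← SetLike.mem_coe, (hΓ f hf).1] at hφ
        exact hφ
      obtain ⟨η, hη, hin⟩ := exists_tendsto_trunc (T := fun f => (Γ f).app φ)
        (N := fun ψ => ν ψ φ) (hR.inner_app φ) hf hi
      have e : Γ f ⟨φ, hφ⟩ = η := ext_inner_left ℂ fun ψ => by
        rw [(hΓ f hf).2 ⟨φ, hφ⟩ ψ, hin ψ]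
      rw [e]
      simpa only [LinearPMap.app_eq] using hη
  · rintro ⟨⟨hdom, hlin, hbdd, hpos⟩, hsup, hmem, hval⟩
    have hd : ∀ {f}, Measurable f → Bdd f → ∀ φ, φ ∈ (Γ f).domain := fun hf hb φ =>
      hdom _ hf hb ▸ Submodule.mem_top
    have hM : MonotoneCalculus Γ := by
      refine ⟨hdom, ?_, ?_, ?_⟩
      · intro f g hf hg hfb hgb c φ
        rw [← LinearPMap.app_eq _ (hd (hf.linear hg c) (hfb.linear hgb c) φ),
          ← LinearPMap.app_eq _ (hd hf hfb φ), ← LinearPMap.app_eq _ (hd hg hgb φ)]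
        exact hlin f g hf hg hfb hgb c φ _ _ _
      · intro f hf h0 hb φ
        have hm := Measurable.complex_ofReal hf
        rw [← LinearPMap.app_eq _ (hd hm hb φ)]
        exact hpos _ hm hb (fun x => ⟨h0 x, Complex.ofReal_im _⟩) φ _
      · intro F f hF h0 hmono hlim hf hb φ
        have hn := fun n => hd (Measurable.complex_ofReal (hF n))
          (bdd_of_monotone_of_tendsto h0 hmono hlim hb n) φ
        have h := hsup F f hF h0 hmono hlim hf hb φ hn (hd (Measurable.complex_ofReal hf) hb φ)
        simpa only [LinearPMap.app_eq] using h
    have hbound : ∀ f, Measurable f → Bdd f → ∃ C : ℝ, ∀ φ, ‖(Γ f).app φ‖ ≤ C * ‖φ‖ := by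
      intro f hf hb
      obtain ⟨C, hC⟩ := hbdd f hf hb
      exact ⟨C, fun φ => by rw [← LinearPMap.app_eq _ (hd hf hb φ)]; exact hC φ _⟩
    obtain ⟨E, ν, hE, hν, hR⟩ := hM.exists_bddRepresents hbound
    have hiff : ∀ {f}, Measurable f → ∀ φ, φ ∈ (Γ f).domain ↔ ∀ ψ, (ν ψ φ).CIntegrable f :=
      fun hf φ => (hmem _ hf φ).trans (hR.mem_domain_iff hf φ).symm
    refine ⟨E, ν, ⟨hE, hν, fun f hf => ⟨Set.ext fun φ => hiff hf φ, ?_⟩⟩, ?_⟩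
    · rintro ⟨φ, hφ⟩ ψ
      obtain ⟨η, hη, hin⟩ := exists_tendsto_trunc (T := fun f => (Γ f).app φ)
        (N := fun ψ => ν ψ φ) (hR.inner_app φ) hf ((hiff hf φ).1 hφ)
      have h := hval f hf φ hφ fun n => hd (trunc_measurable hf n) (trunc_bdd f n) φ
      simp only [(Γ (trunc f _)).app_eq] at h
      rw [tendsto_nhds_unique h hη, hin ψ]
    · rintro E' ν' ⟨-, hν', hΓ'⟩ B hB
      exact operatorMeasure_unique hR (bddRepresents_of_forall hΓ') hν hν' hB
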